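/- Let Z₁, …, Zₙ be bounded metric spaces of positive diameter and assume that asdim(Co(Z₁) × ⋯ × Co(Zₙ)) ≤ k, where Co denotes the hyperbolic cone and the product carries the l∞ metric. Then for some ε̄ > 0 there exists a function δ : (0, ε̄) → (0,1] such that for every ε ∈ (0, ε̄) and every τ ∈ (0,1) there exists a (δ(ε)τ, ετ, k+1)-covering of Z₁ × ⋯ × Zₙ × [0,τ]ⁿ by open subsets of Z₁ × ⋯ × Zₙ × ℝⁿ (all products with the l∞ metric). -/

import Mathlib

open Metric Set Filter ENNReal NNReal

noncomputable section

namespace PaperDefs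

/-! ### Coverings: mesh, Lebesgue number, colorings, multiplicity -/

/-- The mesh of a family of subsets of a metric space. -/
def meshF {Z : Type*} [PseudoMetricSpace Z] (U : Set (Set Z)) : ℝ≥0∞ :=
  ⨆ V ∈ U, EMetric.diam V

/-- The Lebesgue number of a family `U` as a covering of `A`:
`inf_{z ∈ A} sup_{V ∈ U} dist (z, Z \ V)`. -/
def lebesgueF {Z : Type*} [PseudoMetricSpace Z] (U : Set (Set Z)) (A : Set Z) : ℝ≥0∞ :=
  ⨅ z ∈ A, ⨆ V ∈ U, EMetric.infEdist z Vᶜ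

def IsOpenFamily {Z : Type*} [TopologicalSpace Z] (U : Set (Set Z)) : Prop :=
  ∀ V ∈ U, IsOpen V

def IsCoveringOf {Z : Type*} (U : Set (Set Z)) (A : Set Z) : Prop :=
  A ⊆ ⋃₀ U

/-- A family is `m`-colored if it is a union of `m` families, each consisting of
pairwise disjoint sets. -/
def IsColored {Z : Type*} (U : Set (Set Z)) (m : ℕ) : Prop :=
  ∃ F : Fin m → Set (Set Z), U = ⋃ i, F i ∧ ∀ i, (F i).Pairwise Disjoint

/-- The multiplicity of a family is at most `m`: any collection of its members with a
common point has cardinality at most `m`. -/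
def MultiplicityLE {Z : Type*} (U : Set (Set Z)) (m : ℕ) : Prop :=
  ∀ s : Finset (Set Z), ↑s ⊆ U → (⋂₀ (s : Set (Set Z))).Nonempty → s.card ≤ m

/-- An `(L, M, n)`-covering of `A`: an open `n`-colored covering with mesh at most `M`
and Lebesgue number at least `L`. -/
def IsLMNCover {Z : Type*} [PseudoMetricSpace Z] (U : Set (Set Z)) (A : Set Z)
    (L M : ℝ) (n : ℕ) : Prop :=
  IsOpenFamily U ∧ IsCoveringOf U A ∧ IsColored U n ∧
    meshF U ≤ ENNReal.ofReal M ∧ ENNReal.ofReal L ≤ lebesgueF U A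

/-! ### Dimensions -/

/-- `ℓ-dim Z ≤ k`. -/
def ElldimLE (Z : Type*) [PseudoMetricSpace Z] (k : ℕ) : Prop :=
  ∃ δ : ℝ, δ ∈ Set.Ioo (0:ℝ) 1 ∧ ∃ τ₀ : ℝ, 0 < τ₀ ∧ ∀ τ : ℝ, 0 < τ → τ < τ₀ →
    ∃ U : Set (Set Z), IsLMNCover U Set.univ (δ * τ) τ (k + 1)

/-- The linearly controlled dimension of a metric space. -/
def elldim (Z : Type*) [PseudoMetricSpace Z] : ℕ∞ :=
  sInf {n : ℕ∞ | ∃ k : ℕ, n = k ∧ ElldimLE Z k}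

/-- `asdim X ≤ m`. -/
def AsdimLE (X : Type*) [PseudoMetricSpace X] (m : ℕ) : Prop :=
  ∀ d : ℝ, 0 < d → ∃ U : Set (Set X), IsOpenFamily U ∧ IsCoveringOf U Set.univ ∧
    MultiplicityLE U (m + 1) ∧ meshF U < ⊤ ∧ ENNReal.ofReal d ≤ lebesgueF U Set.univ

/-- The asymptotic dimension of a metric space. -/
def asdim (X : Type*) [PseudoMetricSpace X] : ℕ∞ :=
  sInf {n : ℕ∞ | ∃ m : ℕ, n = m ∧ AsdimLE X m}

/-- `ℓ-asdim X ≤ n`. -/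
def LasdimLE (X : Type*) [PseudoMetricSpace X] (n : ℕ) : Prop :=
  ∃ C : ℝ, 1 < C ∧ ∃ d₀ : ℝ, ∀ d : ℝ, d₀ ≤ d →
    ∃ U : Set (Set X), IsLMNCover U Set.univ d (C * d) (n + 1)

/-- The linearly controlled asymptotic dimension of a metric space. -/
def lasdim (X : Type*) [PseudoMetricSpace X] : ℕ∞ :=
  sInf {n : ℕ∞ | ∃ m : ℕ, n = m ∧ LasdimLE X m}

/-- Topological covering dimension `≤ m`: every open covering admits an open refinement of
multiplicity at most `m + 1`. -/
def CovDimLE (Z : Type*) [TopologicalSpace Z] (m : ℕ) : Prop :=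
  ∀ U : Set (Set Z), IsOpenFamily U → IsCoveringOf U Set.univ →
    ∃ V : Set (Set Z), IsOpenFamily V ∧ IsCoveringOf V Set.univ ∧
      (∀ W ∈ V, ∃ W' ∈ U, W ⊆ W') ∧ MultiplicityLE V (m + 1)

/-- Topological covering dimension. -/
def covDim (Z : Type*) [TopologicalSpace Z] : ℕ∞ :=
  sInf {n : ℕ∞ | ∃ m : ℕ, n = m ∧ CovDimLE Z m}

/-! ### Scaled metric spaces and uniform `ℓ-dim` for families -/

/-- `Scaled a X` is the metric space obtained from `X` by multiplying all distances by `a`. -/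
def Scaled (a : ℝ≥0) (X : Type*) : Type _ := X

def Scaled.unmk {a : ℝ≥0} {X : Type*} (x : Scaled a X) : X := x

def Scaled.dist' (a : ℝ≥0) {X : Type*} [PseudoMetricSpace X] (x y : Scaled a X) : ℝ :=
  a * dist x.unmk y.unmk

noncomputable instance Scaled.pseudoMetricSpace (a : ℝ≥0) (X : Type*) [PseudoMetricSpace X] :
    PseudoMetricSpace (Scaled a X) where
  dist := Scaled.dist' a
  dist_self x := by simp [Scaled.dist']
  dist_comm x y := by simp [Scaled.dist', dist_comm]
  dist_triangle x y z := by
    have h := dist_triangle x.unmk y.unmk z.unmk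
    have h2 := mul_le_mul_of_nonneg_left h a.coe_nonneg
    simp only [Scaled.dist']
    calc (a : ℝ) * dist x.unmk z.unmk ≤ a * (dist x.unmk y.unmk + dist y.unmk z.unmk) := h2
      _ = a * dist x.unmk y.unmk + a * dist y.unmk z.unmk := by ring

/-- A family of metric spaces has `ℓ-dim ≤ k` uniformly. -/
def UnifElldimLE {ι : Type*} (Z : ι → Type*) [∀ i, PseudoMetricSpace (Z i)] (k : ℕ) : Prop :=
  ∃ δ : ℝ, δ ∈ Set.Ioo (0:ℝ) 1 ∧ ∃ τ₀ : ℝ, 0 < τ₀ ∧ ∀ τ : ℝ, 0 < τ → τ < τ₀ → ∀ i : ι,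
    ∃ U : Set (Set (Z i)), IsLMNCover U Set.univ (δ * τ) τ (k + 1)

/-! ### `mesh^×` and `L^×` for products -/

/-- `mesh^× U ≤ (p, q)`. -/
def MeshProdLE {X Y : Type*} [PseudoMetricSpace X] [PseudoMetricSpace Y]
    (U : Set (Set (X × Y))) (p q : ℝ) : Prop :=
  ∀ V ∈ U, ∃ x : X, ∃ y : Y, V ⊆ closedBall x p ×ˢ closedBall y q

/-- `L^× U ≥ (p, q)`. -/
def LProdGE {X Y : Type*} [PseudoMetricSpace X] [PseudoMetricSpace Y]
    (U : Set (Set (X × Y))) (p q : ℝ) : Prop :=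
  ∀ z : X × Y, ∃ V ∈ U, closedBall z.1 p ×ˢ closedBall z.2 q ⊆ V

/-- pointed `mesh^× (U, z) ≤ (p, q)`. -/
def MeshProdAtLE {X Y : Type*} [PseudoMetricSpace X] [PseudoMetricSpace Y]
    (U : Set (Set (X × Y))) (z : X × Y) (p q : ℝ) : Prop :=
  ∀ V ∈ U, z ∈ V → ∃ x : X, ∃ y : Y, V ⊆ closedBall x p ×ˢ closedBall y q

/-- pointed `L^× (U, z) ≥ (p, q)`. -/
def LProdAtGE {X Y : Type*} [PseudoMetricSpace X] [PseudoMetricSpace Y]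
    (U : Set (Set (X × Y))) (z : X × Y) (p q : ℝ) : Prop :=
  ∃ V ∈ U, closedBall z.1 p ×ˢ closedBall z.2 q ⊆ V

/-! ### Hyperbolic spaces and their boundaries -/

/-- The Gromov product `(x|y)_o`. -/
def gromov {Z : Type*} [PseudoMetricSpace Z] (o x y : Z) : ℝ :=
  (dist x o + dist y o - dist x y) / 2

/-- `X` is `δ`-hyperbolic. -/
def IsDeltaHyperbolic (X : Type*) [PseudoMetricSpace X] (δ : ℝ) : Prop :=
  0 ≤ δ ∧ ∀ o x y z : X, min (gromov o x z) (gromov o z y) - δ ≤ gromov o x y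

/-- `X` is Gromov hyperbolic. -/
def GromovHyperbolic (X : Type*) [PseudoMetricSpace X] : Prop :=
  ∃ δ : ℝ, IsDeltaHyperbolic X δ

/-- A sequence converges at infinity if `liminf_{i,j → ∞} (x_i | x_j)_o = ∞`. -/
def ConvAtInf {X : Type*} [PseudoMetricSpace X] (o : X) (x : ℕ → X) : Prop :=
  Tendsto (fun p : ℕ × ℕ => gromov o (x p.1) (x p.2)) (atTop ×ˢ atTop) atTop

/-- Sequences converging at infinity. -/
def BdrySeq (X : Type*) [PseudoMetricSpace X] (o : X) := {x : ℕ → X // ConvAtInf o x}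

/-- Equivalence of sequences converging at infinity. -/
def bdryRel (X : Type*) [PseudoMetricSpace X] (o : X) (x y : BdrySeq X o) : Prop :=
  Tendsto (fun p : ℕ × ℕ => gromov o (x.1 p.1) (y.1 p.2)) (atTop ×ˢ atTop) atTop

/-- The boundary at infinity of `X` (with respect to the base point `o`). -/
def Boundary (X : Type*) [PseudoMetricSpace X] (o : X) := Quot (bdryRel X o)

/-- The Gromov product of two boundary points. -/
def bGromov {X : Type*} [PseudoMetricSpace X] (o : X) (ξ η : Boundary X o) : ℝ :=
  sInf {t : ℝ | ∃ x y : BdrySeq X o, Quot.mk (bdryRel X o) x = ξ ∧ Quot.mk (bdryRel X o) y = η ∧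
    t = liminf (fun p : ℕ × ℕ => gromov o (x.1 p.1) (y.1 p.2)) (atTop ×ˢ atTop)}

/-- The Gromov product of a point of the space and a boundary point. -/
def mGromov {X : Type*} [PseudoMetricSpace X] (o : X) (x : X) (ξ : Boundary X o) : ℝ :=
  sInf {t : ℝ | ∃ y : BdrySeq X o, Quot.mk (bdryRel X o) y = ξ ∧
    t = liminf (fun j : ℕ => gromov o x (y.1 j)) atTop}

/-- A hyperbolic space is visual. -/
def IsVisualSpace (X : Type*) [PseudoMetricSpace X] : Prop :=
  ∃ x₀ : X, ∃ D : ℝ, 0 < D ∧ ∀ x : X, ∃ ξ : Boundary X x₀,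
    dist x x₀ ≤ mGromov x₀ x ξ + D

/-- `B` is a copy of the boundary at infinity of `X` (realized by the bijection `φ`)
equipped with a visual metric. -/
def IsVisualBoundary (X : Type*) [PseudoMetricSpace X] (o : X)
    (B : Type*) [PseudoMetricSpace B] (φ : B ≃ Boundary X o) : Prop :=
  ∃ a : ℝ, 1 < a ∧ ∃ c₁ c₂ : ℝ, 0 < c₁ ∧ 0 < c₂ ∧ ∀ ξ ξ' : B,
    c₁ * a ^ (-(bGromov o (φ ξ) (φ ξ'))) ≤ dist ξ ξ' ∧
    dist ξ ξ' ≤ c₂ * a ^ (-(bGromov o (φ ξ) (φ ξ')))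

/-- A geodesic from `x` to `y`: an isometric parametrization of `[0, dist x y]`
sending `0` to `x` and `dist x y` to `y`. -/
def IsGeodesicFrom {Z : Type*} [PseudoMetricSpace Z] (f : ℝ → Z) (x y : Z) : Prop :=
  f 0 = x ∧ f (dist x y) = y ∧ ∀ s ∈ Set.Icc (0:ℝ) (dist x y), ∀ t ∈ Set.Icc (0:ℝ) (dist x y),
    dist (f s) (f t) = |s - t|

/-- A geodesic metric space. -/
def IsGeodesicSpace (X : Type*) [PseudoMetricSpace X] : Prop :=
  ∀ x y : X, ∃ f : ℝ → X, IsGeodesicFrom f x y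

/-! ### Word metrics and hyperbolic groups -/

/-- The word length of `g` with respect to the (symmetrized) generating set `S`. -/
def wordLength {G : Type*} [Group G] (S : Set G) (g : G) : ℕ :=
  sInf {n : ℕ | ∃ w : List G, w.length = n ∧ (∀ s ∈ w, s ∈ S ∨ s⁻¹ ∈ S) ∧ w.prod = g}

/-- The metric on `G` is the word metric of the finite generating set `S`. -/
def IsWordMetric {G : Type*} [Group G] [PseudoMetricSpace G] (S : Set G) : Prop :=
  S.Finite ∧ Subgroup.closure S = ⊤ ∧ ∀ g h : G, dist g h = wordLength S (g⁻¹ * h)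

/-! ### Hyperbolic cones -/

/-- The inverse hyperbolic cosine. -/
def arcosh (x : ℝ) : ℝ := Real.log (x + Real.sqrt (x ^ 2 - 1))

/-- The hyperbolic cone distance between points of `Z × [0, ∞)`, where `Z` is a bounded
metric space of positive diameter:
`cosh d = cosh t · cosh t' − sinh t · sinh t' · cos (μ |z z'|)` with `μ = π / diam Z`. -/
def coneDist {Z : Type*} [PseudoMetricSpace Z] (p q : Z × ℝ≥0) : ℝ :=
  arcosh (Real.cosh p.2 * Real.cosh q.2 -
    Real.sinh p.2 * Real.sinh q.2 *
      Real.cos (Real.pi / Metric.diam (Set.univ : Set Z) * dist p.1 q.1))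

/-- `C` is (a realization of) the hyperbolic cone over `Z`: `h` is the canonical projection
of `Z × [0, ∞)` onto `C = Z × [0,∞) / Z × {0}`, and the metric of `C` is the hyperbolic
cone metric. -/
def IsHypCone (Z : Type*) [PseudoMetricSpace Z] (C : Type*) [PseudoMetricSpace C]
    (h : Z × ℝ≥0 → C) : Prop :=
  Function.Surjective h ∧ ∀ p q : Z × ℝ≥0, dist (h p) (h q) = coneDist p q

/-- A metric space is locally self-similar. -/
def LocallySelfSimilar (Z : Type*) [PseudoMetricSpace Z] : Prop :=
  ∃ lam : ℝ, 1 ≤ lam ∧ ∃ R₀ : ℝ, 1 < R₀ ∧ ∀ R : ℝ, R₀ ≤ R → ∀ A : Set Z,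
    Metric.diam A ≤ 1 / R → ∃ f : A → Z, ∀ x y : A,
      R * dist (x : Z) (y : Z) / lam ≤ dist (f x) (f y) ∧
      dist (f x) (f y) ≤ lam * R * dist (x : Z) (y : Z)

end PaperDefs

open PaperDefs

/-- A bound on `asdim` is witnessed by coverings of the given multiplicity. -/
theorem asdimLE_of_asdim_le {X : Type*} [PseudoMetricSpace X] {k : ℕ}
    (hk : asdim X ≤ (k : ℕ∞)) : AsdimLE X k := by
  have hne : {n : ℕ∞ | ∃ m : ℕ, n = m ∧ AsdimLE X m}.Nonempty := by
    by_contra hcon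
    rw [Set.not_nonempty_iff_eq_empty] at hcon
    rw [asdim, hcon] at hk
    exact (ENat.natCast_lt_top k).not_ge ((le_sInf fun b hb => absurd hb (by simp)).trans hk)
  obtain ⟨m, hm, hX⟩ := csInf_mem hne
  have hmk : m ≤ k := by
    rw [asdim, hm] at hk
    exact_mod_cast hk
  intro d hd
  obtain ⟨U, h1, h2, h3, h4⟩ := hX d hd
  exact ⟨U, h1, h2, fun s hs hs' => (h3 s hs hs').trans (by omega), h4⟩

theorem mem_of_infEDist_compl_pos {X : Type*} [PseudoEMetricSpace X] {V : Set X} {x : X}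
    (hx : 0 < Metric.infEDist x Vᶜ) : x ∈ V := by
  by_contra hV
  exact hx.ne' (Metric.infEDist_zero_of_mem hV)

/-- The finitely many members of a family of multiplicity at most `m` through a point. -/
theorem PaperDefs.MultiplicityLE.finite_and_card_le {X : Type*} {U : Set (Set X)} {m : ℕ}
    (hU : MultiplicityLE U m) (x : X) :
    {V ∈ U | x ∈ V}.Finite ∧ ∀ s : Finset (Set X), ↑s ⊆ {V ∈ U | x ∈ V} → s.card ≤ m := by
  have key : ∀ s : Finset (Set X), ↑s ⊆ {V ∈ U | x ∈ V} → s.card ≤ m := fun s hs =>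
    hU s (fun V hV => (hs hV).1) ⟨x, fun V hV => (hs hV).2⟩
  refine ⟨?_, key⟩
  by_contra hinf
  obtain ⟨t, ht, hcard⟩ := Set.Infinite.exists_subset_card_eq hinf (m + 1)
  have := key t ht
  omega

/-- The points at which the members of `S` are exactly the members of `U` whose complement is
farther away than some threshold. -/
def depthCell {X : Type*} [PseudoEMetricSpace X] (U : Set (Set X)) (S : Finset (Set X)) :
    Set X :=
  {x | ∃ a : ℝ≥0∞, (∀ V ∈ S, a < Metric.infEDist x Vᶜ) ∧
    ∀ V ∈ U, V ∉ S → Metric.infEDist x Vᶜ ≤ a}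

theorem disjoint_depthCell {X : Type*} [PseudoEMetricSpace X] {U : Set (Set X)}
    {S T : Finset (Set X)} (hS : ↑S ⊆ U) (hT : ↑T ⊆ U) (hcard : S.card = T.card)
    (hST : S ≠ T) : Disjoint (depthCell U S) (depthCell U T) := by
  have sub : ∀ {S T : Finset (Set X)} {a b : ℝ≥0∞} {x : X}, ↑T ⊆ U → a ≤ b →
      (∀ V ∈ U, V ∉ S → Metric.infEDist x Vᶜ ≤ a) →
      (∀ V ∈ T, b < Metric.infEDist x Vᶜ) → T ⊆ S := by
    intro S T a b x hT hab hS' hT' V hV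
    by_contra hVS
    exact absurd ((hT' V hV).trans_le (hS' V (hT hV) hVS)) hab.not_gt
  rw [Set.disjoint_left]
  rintro x ⟨a, ha, ha'⟩ ⟨b, hb, hb'⟩
  rcases le_total a b with hab | hab
  · exact hST (Finset.eq_of_subset_of_card_le (sub hT hab ha' hb) hcard.le).symm
  · exact hST (Finset.eq_of_subset_of_card_le (sub hS hab hb' ha) hcard.ge)

/-- If at most `k + 1` members of `U` contain `x` and one of them contains a ball of radius
larger than `2 (k + 1)` around `x`, the depths of `x` in the members of `U` leave a gap. -/
theorem exists_depth_gap {X : Type*} [PseudoEMetricSpace X] {U : Set (Set X)} {k : ℕ} {x : X}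
    (hcard : ∀ s : Finset (Set X), ↑s ⊆ {V ∈ U | x ∈ V} → s.card ≤ k + 1)
    (hx : ∃ V ∈ U, ((2 * (k + 1) : ℕ) : ℝ≥0∞) < Metric.infEDist x Vᶜ) :
    ∃ r ≤ k, ∀ V ∈ U, Metric.infEDist x Vᶜ ≤ ((2 * r : ℕ) : ℝ≥0∞) ∨
      ((2 * r + 2 : ℕ) : ℝ≥0∞) < Metric.infEDist x Vᶜ := by
  by_contra! hcon
  have hlev : ∀ r : Fin (k + 2), ∃ V ∈ U, ((2 * r.1 : ℕ) : ℝ≥0∞) < Metric.infEDist x Vᶜ ∧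
      (r.1 ≤ k → Metric.infEDist x Vᶜ ≤ ((2 * r.1 + 2 : ℕ) : ℝ≥0∞)) := by
    intro r
    by_cases hr : r.1 ≤ k
    · obtain ⟨V, hV, h1, h2⟩ := hcon r.1 hr
      exact ⟨V, hV, h1, fun _ => h2⟩
    · obtain ⟨V, hV, h1⟩ := hx
      have : r.1 = k + 1 := by have := r.2; omega
      exact ⟨V, hV, by rwa [this], fun h => absurd h hr⟩
  choose V hVU hlow hup using hlev
  have hlt : ∀ r s : Fin (k + 2), r < s → V r ≠ V s := by
    intro r s hrs heq
    have hrs' : r.1 < s.1 := hrs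
    have h1 := hup r (by have := s.2; omega)
    have h2 := hlow s
    rw [heq] at h1
    have h3 : ((2 * s.1 : ℕ) : ℝ≥0∞) < ((2 * r.1 + 2 : ℕ) : ℝ≥0∞) := h2.trans_le h1
    rw [Nat.cast_lt] at h3
    omega
  have hinj : Function.Injective V := by
    intro r s hrs
    rcases lt_trichotomy r s with hlt' | heq | hlt'
    · exact absurd hrs (hlt r s hlt')
    · exact heq
    · exact absurd hrs.symm (hlt s r hlt')
  have := hcard (Finset.univ.map ⟨V, hinj⟩) (by
    intro W hW
    simp only [Finset.coe_map, Function.Embedding.coeFn_mk, Finset.coe_univ, Set.image_univ,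
      Set.mem_range] at hW
    obtain ⟨r, rfl⟩ := hW
    exact ⟨hVU r, mem_of_infEDist_compl_pos (bot_le.trans_lt (hlow r))⟩)
  rw [Finset.card_map, Finset.card_univ, Fintype.card_fin] at this
  omega

/-- A space of asymptotic dimension at most `k` has a `(k + 1)`-colored covering by uniformly
bounded sets such that every unit ball lies in a member of the covering. -/
theorem PaperDefs.AsdimLE.exists_colored {X : Type*} [PseudoMetricSpace X] {k : ℕ} (hX : AsdimLE X k) :
    ∃ (D : ℝ) (F : Fin (k + 1) → Set (Set X)), 0 < D ∧ (∀ i, (F i).Pairwise Disjoint) ∧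
      (∀ i, ∀ V ∈ F i, ∀ x ∈ V, ∀ y ∈ V, dist x y ≤ D) ∧
      ∀ x, ∃ i, ∃ V ∈ F i, Metric.ball x 1 ⊆ V := by
  obtain ⟨U, -, -, hmult, hmesh, hleb⟩ := hX (2 * k + 3 : ℕ) (by positivity)
  refine ⟨max 1 (meshF U).toReal,
    fun i => {W | ∃ S : Finset (Set X), ↑S ⊆ U ∧ S.card = i.1 + 1 ∧ W = depthCell U S},
    by positivity, ?_, ?_, ?_⟩
  · rintro i _ ⟨S, hS, hSc, rfl⟩ _ ⟨T, hT, hTc, rfl⟩ hne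
    exact disjoint_depthCell hS hT (hSc.trans hTc.symm) (fun h => hne (by rw [h]))
  · rintro i _ ⟨S, hS, hSc, rfl⟩ x ⟨a, ha, -⟩ y ⟨b, hb, -⟩
    obtain ⟨V, hV⟩ : S.Nonempty := Finset.card_pos.1 (by omega)
    have hxV := mem_of_infEDist_compl_pos (bot_le.trans_lt (ha V hV))
    have hyV := mem_of_infEDist_compl_pos (bot_le.trans_lt (hb V hV))
    have hdiam : edist x y ≤ meshF U :=
      (Metric.edist_le_ediam_of_mem hxV hyV).trans
        (le_iSup₂ (f := fun V (_ : V ∈ U) => Metric.ediam V) V (hS hV))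
    refine le_max_of_le_right ?_
    rw [dist_edist]
    exact ENNReal.toReal_mono hmesh.ne hdiam
  · intro x
    obtain ⟨hfin, hcard⟩ := hmult.finite_and_card_le x
    have hdeep : ∃ V ∈ U, ((2 * (k + 1) : ℕ) : ℝ≥0∞) < Metric.infEDist x Vᶜ := by
      have h1 : ((2 * k + 3 : ℕ) : ℝ≥0∞) ≤ ⨆ V ∈ U, Metric.infEDist x Vᶜ := by
        rw [← ENNReal.ofReal_natCast]
        exact hleb.trans (iInf₂_le x (Set.mem_univ x))
      have h2 : ((2 * (k + 1) : ℕ) : ℝ≥0∞) < ⨆ V ∈ U, Metric.infEDist x Vᶜ :=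
        lt_of_lt_of_le (by rw [Nat.cast_lt]; omega) h1
      simpa only [lt_iSup_iff, exists_prop] using h2
    obtain ⟨r, hr, hgap⟩ := exists_depth_gap hcard hdeep
    have hfin' : {V ∈ U | ((2 * r + 2 : ℕ) : ℝ≥0∞) < Metric.infEDist x Vᶜ}.Finite :=
      hfin.subset fun V hV => ⟨hV.1, mem_of_infEDist_compl_pos (bot_le.trans_lt hV.2)⟩
    have hSmem : ∀ V, V ∈ hfin'.toFinset ↔
        V ∈ U ∧ ((2 * r + 2 : ℕ) : ℝ≥0∞) < Metric.infEDist x Vᶜ := by simp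
    have hSle : hfin'.toFinset.card ≤ k + 1 := hcard _ fun V hV => by
      have hV' := (hSmem V).1 hV
      exact ⟨hV'.1, mem_of_infEDist_compl_pos (bot_le.trans_lt hV'.2)⟩
    have hSpos : 0 < hfin'.toFinset.card := by
      obtain ⟨V, hV, hxV⟩ := hdeep
      refine Finset.card_pos.2 ⟨V, (hSmem V).2 ⟨hV, lt_of_le_of_lt ?_ hxV⟩⟩
      rw [Nat.cast_le]
      omega
    refine ⟨⟨hfin'.toFinset.card - 1, by omega⟩, depthCell U hfin'.toFinset,
      ⟨hfin'.toFinset, fun V hV => ((hSmem V).1 hV).1, by simp only; omega, rfl⟩, ?_⟩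
    intro y hy
    have hyx : edist y x ≤ 1 := by
      rw [edist_dist]
      exact ENNReal.ofReal_le_one.2 (Metric.mem_ball.1 hy).le
    refine ⟨((2 * r + 1 : ℕ) : ℝ≥0∞), fun V hV => ?_, fun V hV hVS => ?_⟩
    · have h1 := ((hSmem V).1 hV).2
      have h2 : ((2 * r + 1 : ℕ) : ℝ≥0∞) + 1 < Metric.infEDist y Vᶜ + 1 := by
        calc ((2 * r + 1 : ℕ) : ℝ≥0∞) + 1 = ((2 * r + 2 : ℕ) : ℝ≥0∞) := by push_cast; ring
          _ < Metric.infEDist x Vᶜ := h1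
          _ ≤ Metric.infEDist y Vᶜ + edist x y := Metric.infEDist_le_infEDist_add_edist
          _ ≤ Metric.infEDist y Vᶜ + 1 := by rw [edist_comm]; gcongr
      exact lt_of_add_lt_add_right h2
    · have h1 : Metric.infEDist x Vᶜ ≤ ((2 * r : ℕ) : ℝ≥0∞) :=
        (hgap V hV).resolve_right fun h => hVS ((hSmem V).2 ⟨hV, h⟩)
      calc Metric.infEDist y Vᶜ ≤ Metric.infEDist x Vᶜ + edist y x :=
            Metric.infEDist_le_infEDist_add_edist
        _ ≤ ((2 * r : ℕ) : ℝ≥0∞) + 1 := by gcongr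
        _ = ((2 * r + 1 : ℕ) : ℝ≥0∞) := by push_cast; ring

/-- The law of cosines in the hyperbolic cone. -/
theorem PaperDefs.IsHypCone.cosh_dist {Z C : Type*} [PseudoMetricSpace Z] [PseudoMetricSpace C]
    {h : Z × ℝ≥0 → C} (hc : IsHypCone Z C h) (p q : Z × ℝ≥0) :
    Real.cosh (dist (h p) (h q)) = Real.cosh (p.2 - q.2) + Real.sinh p.2 * Real.sinh q.2 *
      (1 - Real.cos (Real.pi / Metric.diam (Set.univ : Set Z) * dist p.1 q.1)) := by
  have h0 : 0 ≤ Real.sinh p.2 * Real.sinh q.2 :=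
    mul_nonneg (Real.sinh_nonneg_iff.2 p.2.2) (Real.sinh_nonneg_iff.2 q.2.2)
  have h1 := Real.cos_le_one (Real.pi / Metric.diam (Set.univ : Set Z) * dist p.1 q.1)
  have h2 := Real.one_le_cosh ((p.2 : ℝ) - q.2)
  have h3 := Real.cosh_sub (p.2 : ℝ) q.2
  have h4 := mul_nonneg h0 (sub_nonneg.2 h1)
  rw [hc.2 p q]
  change Real.cosh (Real.arcosh _) = _
  rw [Real.cosh_arcosh (by linarith)]
  linarith

theorem sinh_add_le {a b : ℝ} (ha : 0 ≤ a) (hb : 0 ≤ b) :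
    Real.sinh (a + b) ≤ Real.exp b * (Real.sinh a + 1) := by
  have h1 : Real.cosh a ≤ Real.sinh a + 1 := by
    have := Real.cosh_sub_sinh a
    have : Real.exp (-a) ≤ 1 := Real.exp_le_one_iff.2 (by linarith)
    linarith
  have h2 : 0 ≤ Real.sinh b := Real.sinh_nonneg_iff.2 hb
  have h3 := Real.cosh_pos b
  rw [Real.sinh_add, ← Real.cosh_add_sinh b]
  nlinarith

/-- Points of a hyperbolic cone at bounded distance and far from the apex have close
directions. -/
theorem PaperDefs.IsHypCone.dist_le_of_dist_le {Z C : Type*} [PseudoMetricSpace Z] [PseudoMetricSpace C]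
    {h : Z × ℝ≥0 → C} (hc : IsHypCone Z C h) (hb : Bornology.IsBounded (Set.univ : Set Z))
    (hd : 0 < Metric.diam (Set.univ : Set Z)) {D m : ℝ} (hm : 0 < m) {p q : Z × ℝ≥0}
    (hp : Metric.diam (Set.univ : Set Z) * m ≤ Real.sinh p.2)
    (hq : Metric.diam (Set.univ : Set Z) * m ≤ Real.sinh q.2)
    (hpq : dist (h p) (h q) ≤ D) :
    dist p.1 q.1 ≤ Real.cosh D / m ∧ |(p.2 : ℝ) - q.2| ≤ D := by
  have hD : 0 ≤ D := dist_nonneg.trans hpq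
  have hcosh : Real.cosh (dist (h p) (h q)) ≤ Real.cosh D := by
    rw [Real.cosh_le_cosh, abs_of_nonneg dist_nonneg, abs_of_nonneg hD]
    exact hpq
  rw [hc.cosh_dist] at hcosh
  set Δ := Metric.diam (Set.univ : Set Z)
  set r := dist p.1 q.1 with hr
  have hr0 : 0 ≤ r := dist_nonneg
  have hrΔ : r ≤ Δ := Metric.dist_le_diam_of_mem hb (Set.mem_univ _) (Set.mem_univ _)
  have hpi := Real.pi_pos
  have hΔm : 0 < Δ * m := mul_pos hd hm
  have hcos0 := Real.cos_le_one (Real.pi / Δ * r)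
  have hsinh : Δ * m * (Δ * m) ≤ Real.sinh p.2 * Real.sinh q.2 :=
    mul_le_mul hp hq hΔm.le (hΔm.le.trans hp)
  have hsinh0 : 0 ≤ Real.sinh p.2 * Real.sinh q.2 := (by positivity : (0:ℝ) ≤ _).trans hsinh
  constructor
  · have hcos : Real.cos (Real.pi / Δ * r) ≤ 1 - 2 / Real.pi ^ 2 * (Real.pi / Δ * r) ^ 2 := by
      refine Real.cos_le_one_sub_mul_cos_sq ?_
      rw [abs_of_nonneg (by positivity), div_mul_eq_mul_div, div_le_iff₀ hd]
      exact mul_le_mul_of_nonneg_left hrΔ hpi.le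
    have heq : 2 / Real.pi ^ 2 * (Real.pi / Δ * r) ^ 2 = 2 * r ^ 2 / Δ ^ 2 := by
      field_simp
    rw [heq] at hcos
    have h1 : Δ * m * (Δ * m) * (2 * r ^ 2 / Δ ^ 2) ≤
        Real.sinh p.2 * Real.sinh q.2 * (1 - Real.cos (Real.pi / Δ * r)) :=
      mul_le_mul hsinh (by linarith) (by positivity) hsinh0
    have h2 : Δ * m * (Δ * m) * (2 * r ^ 2 / Δ ^ 2) = 2 * (r * m) ^ 2 := by
      field_simp
    have h3 := Real.one_le_cosh ((p.2 : ℝ) - q.2)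
    have h4 := Real.one_le_cosh D
    rw [le_div_iff₀ hm]
    refine abs_le_of_sq_le_sq' ?_ (by linarith) |>.2
    nlinarith [sq_nonneg (r * m)]
  · have h1 : Real.cosh ((p.2 : ℝ) - q.2) ≤ Real.cosh D := by
      have := mul_nonneg hsinh0 (sub_nonneg.2 hcos0)
      linarith
    rwa [Real.cosh_le_cosh, abs_of_nonneg hD] at h1

/-- Points of a hyperbolic cone with close radii and close directions are close. -/
theorem PaperDefs.IsHypCone.cosh_dist_le {Z C : Type*} [PseudoMetricSpace Z] [PseudoMetricSpace C]
    {h : Z × ℝ≥0 → C} (hc : IsHypCone Z C h) {s a b : ℝ} {p q : Z × ℝ≥0}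
    (hp : Real.sinh p.2 ≤ s) (hq : Real.sinh q.2 ≤ s) (ha : |(p.2 : ℝ) - q.2| ≤ a)
    (hb : s * (Real.pi / Metric.diam (Set.univ : Set Z)) * dist p.1 q.1 ≤ b) :
    Real.cosh (dist (h p) (h q)) ≤ Real.cosh a + b ^ 2 / 2 := by
  rw [hc.cosh_dist]
  have hp0 : 0 ≤ Real.sinh p.2 := Real.sinh_nonneg_iff.2 p.2.2
  have hq0 : 0 ≤ Real.sinh q.2 := Real.sinh_nonneg_iff.2 q.2.2
  have hs0 : 0 ≤ s := hp0.trans hp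
  have hθ : 0 ≤ Real.pi / Metric.diam (Set.univ : Set Z) * dist p.1 q.1 :=
    mul_nonneg (div_nonneg Real.pi_pos.le Metric.diam_nonneg) dist_nonneg
  set θ := Real.pi / Metric.diam (Set.univ : Set Z) * dist p.1 q.1
  have hb' : s * θ ≤ b := by rwa [mul_assoc] at hb
  have h1 : Real.cosh ((p.2 : ℝ) - q.2) ≤ Real.cosh a := by
    rw [Real.cosh_le_cosh]
    exact ha.trans (le_abs_self a)
  have h2 : Real.sinh p.2 * Real.sinh q.2 * (1 - Real.cos θ) ≤ s * s * (θ ^ 2 / 2) := by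
    refine mul_le_mul (mul_le_mul hp hq hq0 hs0) ?_ (sub_nonneg.2 (Real.cos_le_one θ))
      (mul_nonneg hs0 hs0)
    linarith [Real.one_sub_sq_div_two_le_cos (x := θ)]
  have h3 : (s * θ) ^ 2 ≤ b ^ 2 := pow_le_pow_left₀ (mul_nonneg hs0 hθ) hb' 2
  nlinarith

theorem exists_small_cosh (l B : ℝ) :
    ∃ δ : ℝ, 0 < δ ∧ δ ≤ 1 ∧ Real.cosh (l * δ) + (B * δ) ^ 2 / 2 < Real.cosh 1 := by
  have hcont : Continuous fun δ : ℝ => Real.cosh (l * δ) + (B * δ) ^ 2 / 2 := by fun_prop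
  have h0 : Real.cosh (l * 0) + (B * 0) ^ 2 / 2 < Real.cosh 1 := by
    simp
  have hev := (hcont.tendsto 0).eventually (gt_mem_nhds h0)
  obtain ⟨η, hη, hball⟩ := Metric.eventually_nhds_iff.1 hev
  refine ⟨min (η / 2) 1, by positivity, min_le_right _ _, hball ?_⟩
  rw [Real.dist_eq, sub_zero, abs_of_pos (by positivity)]
  exact (min_le_left _ _).trans_lt (by linarith)

/-- The map `Z × ℝ → Z × [0, ∞)` that sends the strip of height `τ` to an annulus of width
`l` at distance about `R` from the apex. -/
def annulusMap {Z : Type*} (R l τ : ℝ) (z : Z) (t : ℝ) : Z × ℝ≥0 :=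
  (z, Real.toNNReal (R + l * (1 + t / τ)))

theorem annulusMap_snd {Z : Type*} {R l τ : ℝ} (hR : 0 ≤ R) (hl : 0 ≤ l) (hτ : 0 < τ) (z : Z)
    {t : ℝ} (ht : t ∈ Set.Ioo (-τ) (2 * τ)) :
    ((annulusMap R l τ z t).2 : ℝ) = R + l * (1 + t / τ) ∧
      R ≤ (annulusMap R l τ z t).2 ∧ ((annulusMap R l τ z t).2 : ℝ) ≤ R + 3 * l := by
  have h1 : -1 ≤ t / τ := by rw [le_div_iff₀ hτ]; linarith [ht.1]
  have h2 : t / τ ≤ 2 := by rw [div_le_iff₀ hτ]; exact ht.2.le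
  have h3 : 0 ≤ l * (1 + t / τ) := mul_nonneg hl (by linarith)
  have h4 : ((annulusMap R l τ z t).2 : ℝ) = R + l * (1 + t / τ) :=
    Real.coe_toNNReal _ (by linarith)
  refine ⟨h4, by linarith, ?_⟩
  rw [h4]
  nlinarith

/-- The radius at which the unit sphere of the cone is stretched by the factor `M / τ`. -/
def annulusRadius (Z : Type*) [PseudoMetricSpace Z] (M τ : ℝ) : ℝ :=
  Real.arsinh (Metric.diam (Set.univ : Set Z) * (M / τ))

theorem annulusRadius_nonneg (Z : Type*) [PseudoMetricSpace Z] {M τ : ℝ} (hM : 0 ≤ M)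
    (hτ : 0 ≤ τ) : 0 ≤ annulusRadius Z M τ :=
  Real.arsinh_nonneg_iff.2 (mul_nonneg Metric.diam_nonneg (div_nonneg hM hτ))

theorem PaperDefs.IsHypCone.annulus_lower {Z C : Type*} [PseudoMetricSpace Z] [PseudoMetricSpace C]
    {h : Z × ℝ≥0 → C} (hc : IsHypCone Z C h) (hb : Bornology.IsBounded (Set.univ : Set Z))
    (hd : 0 < Metric.diam (Set.univ : Set Z)) {D ε τ : ℝ} (hD : 0 < D) (hε : 0 < ε)
    (hτ : 0 < τ) {z z' : Z} {t t' : ℝ} (ht : t ∈ Set.Ioo (-τ) (2 * τ))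
    (ht' : t' ∈ Set.Ioo (-τ) (2 * τ))
    (hdist : dist (h (annulusMap (annulusRadius Z (Real.cosh D / ε) τ) (D / ε) τ z t))
      (h (annulusMap (annulusRadius Z (Real.cosh D / ε) τ) (D / ε) τ z' t')) ≤ D) :
    dist z z' ≤ ε * τ ∧ dist t t' ≤ ε * τ := by
  have hcD := Real.cosh_pos D
  have hM : 0 < Real.cosh D / ε := by positivity
  have hR := annulusRadius_nonneg Z hM.le hτ.le
  have hl : 0 < D / ε := by positivity
  obtain ⟨h1, h2, -⟩ := annulusMap_snd hR hl.le hτ z ht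
  obtain ⟨h1', h2', -⟩ := annulusMap_snd hR hl.le hτ z' ht'
  have hs : Real.sinh (annulusRadius Z (Real.cosh D / ε) τ) =
      Metric.diam (Set.univ : Set Z) * (Real.cosh D / ε / τ) := Real.sinh_arsinh _
  obtain ⟨h3, h4⟩ := hc.dist_le_of_dist_le hb hd (m := Real.cosh D / ε / τ) (by positivity)
    (hs.symm.le.trans (Real.sinh_le_sinh.2 h2)) (hs.symm.le.trans (Real.sinh_le_sinh.2 h2'))
    hdist
  constructor
  · refine h3.trans (le_of_eq ?_)
    field_simp
  · rw [h1, h1'] at h4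
    have h5 : annulusRadius Z (Real.cosh D / ε) τ + D / ε * (1 + t / τ) -
        (annulusRadius Z (Real.cosh D / ε) τ + D / ε * (1 + t' / τ)) =
        D / (ε * τ) * (t - t') := by
      field_simp
      ring
    rw [h5, abs_mul, abs_of_pos (by positivity), div_mul_eq_mul_div,
      div_le_iff₀ (by positivity)] at h4
    rw [Real.dist_eq]
    exact le_of_mul_le_mul_left h4 hD

theorem PaperDefs.IsHypCone.annulus_upper {Z C : Type*} [PseudoMetricSpace Z] [PseudoMetricSpace C]
    {h : Z × ℝ≥0 → C} (hc : IsHypCone Z C h)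
    (hd : 0 < Metric.diam (Set.univ : Set Z)) {M N l δ τ : ℝ} (hM : 0 ≤ M) (hl : 0 ≤ l)
    (hN : (Metric.diam (Set.univ : Set Z))⁻¹ ≤ N)
    (hδ : Real.cosh (l * δ) + (Real.pi * Real.exp (3 * l) * (M + N) * δ) ^ 2 / 2 < Real.cosh 1)
    (hτ : 0 < τ) (hτ1 : τ < 1) {z z' : Z} {t t' : ℝ} (ht : t ∈ Set.Ioo (-τ) (2 * τ))
    (ht' : t' ∈ Set.Ioo (-τ) (2 * τ)) (hz : dist z z' ≤ δ * τ) (htt : dist t t' ≤ δ * τ) :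
    dist (h (annulusMap (annulusRadius Z M τ) l τ z t))
      (h (annulusMap (annulusRadius Z M τ) l τ z' t')) < 1 := by
  have hR := annulusRadius_nonneg Z hM hτ.le
  obtain ⟨h1, -, h2⟩ := annulusMap_snd hR hl hτ z ht
  obtain ⟨h1', -, h2'⟩ := annulusMap_snd hR hl hτ z' ht'
  have hs : Real.sinh (annulusRadius Z M τ) =
      Metric.diam (Set.univ : Set Z) * (M / τ) := Real.sinh_arsinh _
  have hsinh := sinh_add_le hR (b := 3 * l) (by positivity)
  have hcosh : Real.cosh (dist (h (annulusMap (annulusRadius Z M τ) l τ z t))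
      (h (annulusMap (annulusRadius Z M τ) l τ z' t'))) ≤
      Real.cosh (l * δ) + (Real.pi * Real.exp (3 * l) * (M + N) * δ) ^ 2 / 2 := by
    refine hc.cosh_dist_le ((Real.sinh_le_sinh.2 h2).trans hsinh)
      ((Real.sinh_le_sinh.2 h2').trans hsinh) ?_ ?_
    · have h5 : annulusRadius Z M τ + l * (1 + t / τ) -
          (annulusRadius Z M τ + l * (1 + t' / τ)) = l * ((t - t') / τ) := by
        ring
      rw [h1, h1', h5, abs_mul, abs_of_nonneg hl, abs_div, abs_of_pos hτ]
      refine mul_le_mul_of_nonneg_left ?_ hl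
      rw [div_le_iff₀ hτ]
      exact htt
    · change _ * _ * dist z z' ≤ _
      rw [hs]
      have hδ0 : 0 ≤ δ := by
        have := dist_nonneg.trans htt
        exact nonneg_of_mul_nonneg_left this hτ
      have hpi := Real.pi_pos
      set Δ := Metric.diam (Set.univ : Set Z)
      have h6 : Real.exp (3 * l) * (Δ * (M / τ) + 1) * (Real.pi / Δ) * dist z z' ≤
          Real.exp (3 * l) * (Δ * (M / τ) + 1) * (Real.pi / Δ) * (δ * τ) := by gcongr
      have h7 : Real.exp (3 * l) * (Δ * (M / τ) + 1) * (Real.pi / Δ) * (δ * τ) =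
          Real.pi * Real.exp (3 * l) * (M + Δ⁻¹ * τ) * δ := by
        field_simp
      have hΔ : 0 < Δ⁻¹ := inv_pos.2 hd
      have h8 : Δ⁻¹ * τ ≤ N := (mul_le_of_le_one_right hΔ.le hτ1.le).trans hN
      rw [h7] at h6
      refine h6.trans ?_
      gcongr
  have := Real.cosh_lt_cosh.1 (hcosh.trans_lt hδ)
  rwa [abs_of_nonneg dist_nonneg, abs_one] at this

/-- A colored covering of `X` pulls back, along a map that is only controlled on `B`, to a
covering by open sets of those points that are well inside `B`. -/
theorem exists_isLMNCover_of_map {X Y : Type*} [PseudoMetricSpace X] [PseudoMetricSpace Y]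
    {k : ℕ} {D L M : ℝ} {F : Fin (k + 1) → Set (Set X)}
    (hdisj : ∀ i, (F i).Pairwise Disjoint)
    (hdiam : ∀ i, ∀ V ∈ F i, ∀ x ∈ V, ∀ y ∈ V, dist x y ≤ D)
    (hball : ∀ x, ∃ i, ∃ V ∈ F i, Metric.ball x 1 ⊆ V)
    (f : Y → X) {A B : Set Y} (hL : 0 < L)
    (hAB : ∀ p ∈ A, Metric.ball p L ⊆ B)
    (hlow : ∀ p ∈ B, ∀ q ∈ B, dist (f p) (f q) ≤ D → dist p q ≤ M)
    (hup : ∀ p ∈ B, ∀ q ∈ B, dist p q < L → dist (f p) (f q) < 1) :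
    ∃ U : Set (Set Y), IsLMNCover U A L M (k + 1) := by
  have hin : ∀ p ∈ A, ∃ i, ∃ V ∈ F i, Metric.ball p L ⊆ interior (f ⁻¹' V ∩ B) := by
    intro p hp
    obtain ⟨i, V, hV, hVball⟩ := hball (f p)
    refine ⟨i, V, hV, interior_maximal (fun q hq => ?_) Metric.isOpen_ball⟩
    have hqB := hAB p hp hq
    exact ⟨hVball (hup q hqB p (hAB p hp (Metric.mem_ball_self hL)) hq), hqB⟩
  refine ⟨⋃ i, (fun V => interior (f ⁻¹' V ∩ B)) '' F i, ?_, ?_, ⟨_, rfl, ?_⟩, ?_, ?_⟩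
  · intro W hW
    obtain ⟨i, V, hV, rfl⟩ := Set.mem_iUnion.1 hW
    exact isOpen_interior
  · intro p hp
    obtain ⟨i, V, hV, hsub⟩ := hin p hp
    exact ⟨_, Set.mem_iUnion.2 ⟨i, V, hV, rfl⟩, hsub (Metric.mem_ball_self hL)⟩
  · rintro i _ ⟨V, hV, rfl⟩ _ ⟨W, hW, rfl⟩ hne
    have hVW : Disjoint V W := hdisj i hV hW (fun h => hne (by rw [h]))
    exact (hVW.preimage f).mono (interior_subset.trans Set.inter_subset_left)
      (interior_subset.trans Set.inter_subset_left)
  · refine iSup₂_le fun W hW => ?_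
    obtain ⟨i, V, hV, rfl⟩ := Set.mem_iUnion.1 hW
    refine Metric.ediam_le fun p hp q hq => ?_
    have hp' := interior_subset hp
    have hq' := interior_subset hq
    rw [edist_dist]
    exact ENNReal.ofReal_le_ofReal
      (hlow p hp'.2 q hq'.2 (hdiam i V hV _ hp'.1 _ hq'.1))
  · refine le_iInf₂ fun p hp => ?_
    obtain ⟨i, V, hV, hsub⟩ := hin p hp
    refine le_trans ?_ (le_iSup₂ (f := fun W (_ : W ∈ ⋃ i,
      (fun V => interior (f ⁻¹' V ∩ B)) '' F i) => Metric.infEDist p Wᶜ) _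
      (Set.mem_iUnion.2 ⟨i, V, hV, rfl⟩))
    refine Metric.le_infEDist.2 fun q hq => ?_
    rw [edist_dist]
    refine ENNReal.ofReal_le_ofReal ?_
    by_contra! hlt
    exact hq (hsub (by rwa [Metric.mem_ball, dist_comm]))

/-- **Lemma (asprod>1).** If `asdim (Co Z₁ × ⋯ × Co Zₙ) ≤ k`, then for some `ε̄ > 0` there
is a function `δ : (0, ε̄) → (0, 1]` such that for all `ε ∈ (0, ε̄)` and `τ ∈ (0, 1)` there
is a `(δ(ε) τ, ε τ, k+1)`-covering of `Z₁ × ⋯ × Zₙ × [0, τ]ⁿ` by open subsets of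
`Z₁ × ⋯ × Zₙ × ℝⁿ`. -/
theorem covering_of_asdim_cone_le
    (n k : ℕ) (Z : Fin n → Type*) [∀ i, MetricSpace (Z i)]
    (hb : ∀ i, Bornology.IsBounded (Set.univ : Set (Z i)))
    (hd : ∀ i, 0 < Metric.diam (Set.univ : Set (Z i)))
    (C : Fin n → Type*) [∀ i, MetricSpace (C i)]
    (h : ∀ i, Z i × ℝ≥0 → C i) (hc : ∀ i, IsHypCone (Z i) (C i) (h i))
    (hk : asdim (∀ i, C i) ≤ (k : ℕ∞)) :
    ∃ ε₀ : ℝ, 0 < ε₀ ∧ ∃ δ : ℝ → ℝ,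
      (∀ ε : ℝ, 0 < ε → ε < ε₀ → 0 < δ ε ∧ δ ε ≤ 1) ∧
      ∀ ε : ℝ, 0 < ε → ε < ε₀ → ∀ τ : ℝ, 0 < τ → τ < 1 →
        ∃ U : Set (Set ((∀ i, Z i) × (Fin n → ℝ))),
          IsLMNCover U {p : (∀ i, Z i) × (Fin n → ℝ) | ∀ i, p.2 i ∈ Set.Icc 0 τ}
            (δ ε * τ) (ε * τ) (k + 1) := by
  obtain ⟨D, F, hD, hdisj, hdiam, hball⟩ := (asdimLE_of_asdim_le hk).exists_colored
  let N : ℝ := ∑ i, (Metric.diam (Set.univ : Set (Z i)))⁻¹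
  have hN : ∀ i, (Metric.diam (Set.univ : Set (Z i)))⁻¹ ≤ N := fun i =>
    Finset.single_le_sum (f := fun i => (Metric.diam (Set.univ : Set (Z i)))⁻¹)
      (fun j _ => (inv_pos.2 (hd j)).le) (Finset.mem_univ i)
  choose δ hδ0 hδ1 hδ using fun ε : ℝ => exists_small_cosh (D / ε)
    (Real.pi * Real.exp (3 * (D / ε)) * (Real.cosh D / ε + N))
  refine ⟨1, one_pos, δ, fun ε _ _ => ⟨hδ0 ε, hδ1 ε⟩, fun ε hε _ τ hτ hτ1 => ?_⟩
  have hcD := Real.cosh_pos D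
  refine exists_isLMNCover_of_map hdisj hdiam hball
    (fun p i => h i (annulusMap (annulusRadius (Z i) (Real.cosh D / ε) τ) (D / ε) τ
      (p.1 i) (p.2 i)))
    (B := {p | ∀ i, p.2 i ∈ Set.Ioo (-τ) (2 * τ)}) (mul_pos (hδ0 ε) hτ) ?_ ?_ ?_
  · intro p hp q hq i
    have h1 : dist (q.2 i) (p.2 i) < δ ε * τ :=
      (dist_le_pi_dist q.2 p.2 i).trans_lt ((le_max_right _ _).trans_lt hq)
    have h2 : δ ε * τ ≤ τ := mul_le_of_le_one_left hτ.le (hδ1 ε)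
    rw [Real.dist_eq, abs_lt] at h1
    have h3 := hp i
    constructor <;> linarith [h3.1, h3.2, h1.1, h1.2]
  · intro p hp q hq hpq
    have key := fun i => (hc i).annulus_lower (hb i) (hd i) hD hε hτ (hp i) (hq i)
      ((dist_le_pi_dist _ _ i).trans hpq)
    have h0 : 0 ≤ ε * τ := by positivity
    exact max_le ((dist_pi_le_iff h0).2 fun i => (key i).1)
      ((dist_pi_le_iff h0).2 fun i => (key i).2)
  · intro p hp q hq hpq
    refine (dist_pi_lt_iff one_pos).2 fun i => ?_
    exact (hc i).annulus_upper (hd i) (by positivity) (by positivity) (hN i) (hδ ε) hτ hτ1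
      (hp i) (hq i)
      ((dist_le_pi_dist p.1 q.1 i).trans ((le_max_left _ _).trans hpq.le))
      ((dist_le_pi_dist p.2 q.2 i).trans ((le_max_right _ _).trans hpq.le))
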